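/- For any finite multigraph G (possibly with loops) and any d ≥ 1, the univariate d-matching polynomial μ_{d,G}(x), defined as the uniform average of matching polynomials μ_H(x) over all d-sheeted coverings H of G, is real-rooted. -/

import Mathlib

open Finset Polynomial
open scoped Classical

variable {n m d : ℕ}

/-- A finite multigraph `G` on `Fin n` with edges indexed by `Fin m` (edge `e` joins
`hd e` to `tl e`; loops and parallel edges allowed).  For a labeling
`σ : Fin m → S_d`, the `d`-covering `H_σ` has vertices `Fin n × Fin d` and, for each
`(e, k)`, an edge joining `(hd e, k)` to `(tl e, σ e k)`.  These are its endpoints. -/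
def endpoints (hd tl : Fin m → Fin n) (σ : Fin m → Equiv.Perm (Fin d))
    (p : Fin m × Fin d) : Finset (Fin n × Fin d) :=
  {(hd p.1, p.2), (tl p.1, (σ p.1) p.2)}

/-- `M` is a matching of the covering graph `H_σ`: a set of non-loop edges of `H_σ`,
no two of which share a vertex. -/
def IsCovMatching (hd tl : Fin m → Fin n) (σ : Fin m → Equiv.Perm (Fin d))
    (M : Finset (Fin m × Fin d)) : Prop :=
  (∀ p ∈ M, ¬(hd p.1 = tl p.1 ∧ (σ p.1) p.2 = p.2)) ∧
    ∀ p ∈ M, ∀ q ∈ M, p ≠ q → Disjoint (endpoints hd tl σ p) (endpoints hd tl σ q)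

/-- The (univariate) matching polynomial `μ_{H_σ}(x) = ∑_i (-1)^i m_i x^{nd - 2i}`
of the `d`-covering `H_σ`, a graph on `n * d` vertices. -/
noncomputable def covMatchPoly (hd tl : Fin m → Fin n)
    (σ : Fin m → Equiv.Perm (Fin d)) : Polynomial ℝ :=
  ∑ M ∈ Finset.univ.filter (fun M => IsCovMatching hd tl σ M),
    (-1 : ℝ) ^ M.card • (X : Polynomial ℝ) ^ (n * d - 2 * M.card)

/-- The `d`-matching polynomial of `G`: the uniform average of the matching
polynomials of its `d`-sheeted coverings. -/
noncomputable def dMatchPoly (hd tl : Fin m → Fin n) (d : ℕ) : Polynomial ℝ :=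
  (Fintype.card (Fin m → Equiv.Perm (Fin d)) : ℝ)⁻¹ •
    ∑ σ : Fin m → Equiv.Perm (Fin d), covMatchPoly hd tl σ

lemma aux_sum (R : Multiset ℂ) (z w : ℂ) (hz : 0 ≤ z.im) (hR : ∀ r ∈ R, r.im < 0) :
    R = 0 ∨ z.im * (2 * (w.re * ((R.map fun r => 1 / (z - r)).sum).re
      + w.im * ((R.map fun r => 1 / (z - r)).sum).im) - (Multiset.card R) * (w.re ^ 2 + w.im ^ 2))
      < - ((R.map fun r => 1 / (z - r)).sum).im := by
  induction R using Multiset.induction_on with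
  | empty => left; rfl
  | cons r R ih =>
    right
    have hr : r.im < 0 := hR r (by simp)
    have h1 : z.im * (2 * (w.re * (1 / (z - r)).re + w.im * (1 / (z - r)).im)
        - (w.re ^ 2 + w.im ^ 2)) < - (1 / (z - r)).im := by
      set s := z - r with hs
      have hsim : s.im = z.im - r.im := by simp [hs]
      have hs0 : s ≠ 0 := by
        intro h
        rw [h] at hsim
        simp at hsim
        linarith
      have hn : 0 < Complex.normSq s := Complex.normSq_pos.mpr hs0
      have hre : (1 / s).re = s.re / Complex.normSq s := by simp [Complex.inv_re]
      have him : - (1 / s).im = s.im / Complex.normSq s := by simp [Complex.inv_im, neg_div]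
      have hnn : (1 / s).re ^ 2 + (1 / s).im ^ 2 = 1 / Complex.normSq s := by
        have := Complex.normSq_apply (1 / s)
        rw [Complex.normSq_div, map_one] at this
        rw [this]; ring
      have h2 : z.im * ((1 / s).re ^ 2 + (1 / s).im ^ 2) < - (1 / s).im := by
        rw [hnn, him, mul_one_div]
        gcongr
        linarith
      nlinarith [mul_nonneg hz (sq_nonneg (w.re - (1 / s).re)),
        mul_nonneg hz (sq_nonneg (w.im - (1 / s).im))]
    rcases ih (fun r' h => hR r' (by simp [h])) with h | h
    · subst h
      simpa using h1
    · rw [Multiset.map_cons, Multiset.sum_cons, Multiset.card_cons, Complex.add_re, Complex.add_im]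
      push_cast
      nlinarith

lemma laguerre (p : ℂ[X]) (N : ℕ) (hN : 1 ≤ N) (hdeg : p.natDegree ≤ N)
    (hp : ∀ u : ℂ, 0 ≤ u.im → p.eval u ≠ 0) (z ζ : ℂ) (hz : 0 ≤ z.im) (hζ : 0 ≤ ζ.im) :
    (N : ℂ) * p.eval z + (ζ - z) * (derivative p).eval z ≠ 0 := by
  intro h0
  have hpz := hp z hz
  have hW := (IsAlgClosed.splits p).eval_derivative_div_eval_of_ne_zero hpz
  have hNpos : (0 : ℝ) < N := by exact_mod_cast hN
  have hN0 : (N : ℂ) ≠ 0 := by exact_mod_cast hNpos.ne'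
  have hroots : ∀ r ∈ p.roots, r.im < 0 := by
    intro r hr
    by_contra! hc
    exact hp r hc (isRoot_of_mem_roots hr)
  set W := (derivative p).eval z / p.eval z with hWdef
  have hd : (derivative p).eval z = W * p.eval z := by rw [hWdef]; field_simp
  have h1 : (z - ζ) * W = N := by
    rw [hd] at h0
    have : (N + (ζ - z) * W) * p.eval z = 0 := by linear_combination h0
    have := (mul_eq_zero.mp this).resolve_right hpz
    linear_combination -this
  rcases aux_sum p.roots z (W / N) hz hroots with h | h
  · rw [h] at hW
    simp at hW
    rw [hW] at h1
    simp at h1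
    exact hN0 (by simp [← h1])
  · rw [← hW] at h
    have hre : (W / N).re = W.re / N := by simp
    have him : (W / N).im = W.im / N := by simp
    rw [hre, him] at h
    have hcard : ((Multiset.card p.roots : ℕ) : ℝ) ≤ N := by
      exact_mod_cast (card_roots' p).trans hdeg
    have e1 := congrArg Complex.re h1
    have e2 := congrArg Complex.im h1
    simp at e1 e2
    -- s W = N
    have hs : N * W.im = - (z.im - ζ.im) * (W.re ^ 2 + W.im ^ 2) := by
      linear_combination (-W.im) * e1 + W.re * e2
    have hQ : 0 ≤ W.re ^ 2 + W.im ^ 2 := by positivity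
    have hk : z.im * ((W.re ^ 2 + W.im ^ 2) / N) ≤
        z.im * (2 * (W.re / N * W.re + W.im / N * W.im) -
        (Multiset.card p.roots) * ((W.re / N) ^ 2 + (W.im / N) ^ 2)) := by
      apply mul_le_mul_of_nonneg_left _ hz
      have : (2 * (W.re / N * W.re + W.im / N * W.im) -
        (Multiset.card p.roots) * ((W.re / N) ^ 2 + (W.im / N) ^ 2)) =
        (W.re ^ 2 + W.im ^ 2) / N * (2 - Multiset.card p.roots / N) := by
          field_simp
      rw [this]
      have h3 : (Multiset.card p.roots : ℝ) / N ≤ 1 := by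
        rw [div_le_one hNpos]; exact hcard
      have : 0 ≤ (W.re ^ 2 + W.im ^ 2) / N := by positivity
      nlinarith
    have h5 := lt_of_le_of_lt hk h
    have h6 : z.im * (W.re ^ 2 + W.im ^ 2) < - W.im * N := by
      rw [mul_div_assoc', div_lt_iff₀ hNpos] at h5
      exact h5
    nlinarith [mul_nonneg hζ hQ]

lemma laguerre_coeff (c : ℕ → ℂ) (d : ℕ)
    (hp : ∀ u : ℂ, 0 ≤ u.im → ∑ i ∈ range (d + 2), c i * u ^ i ≠ 0)
    (z ζ : ℂ) (hz : 0 ≤ z.im) (hζ : 0 ≤ ζ.im) :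
    ∑ i ∈ range (d + 1), (((d : ℂ) + 1 - i) * c i + ζ * (((i : ℂ) + 1) * c (i + 1))) * z ^ i ≠ 0 := by
  have := laguerre (∑ i ∈ range (d + 2), C (c i) * X ^ i) (d + 1) (by omega)
    (natDegree_sum_le_of_forall_le _ _ (fun i hi => by
      have := mem_range.mp hi
      exact (natDegree_C_mul_X_pow_le _ _).trans (by omega)))
    (fun u hu => by simpa [eval_finsetSum] using hp u hu) z ζ hz hζ
  convert this using 1
  have hder : (derivative (∑ i ∈ range (d + 2), C (c i) * X ^ i)).eval z
      = ∑ i ∈ range (d + 1), ((i : ℂ) + 1) * c (i + 1) * z ^ i := by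
    rw [derivative_sum, eval_finsetSum, sum_range_succ']
    simp
    refine sum_congr rfl fun i _ => ?_
    ring
  have hzder : z * (derivative (∑ i ∈ range (d + 2), C (c i) * X ^ i)).eval z
      = ∑ i ∈ range (d + 2), (i : ℂ) * c i * z ^ i := by
    rw [hder, sum_range_succ' (fun i : ℕ => (i : ℂ) * c i * z ^ i), mul_sum]
    simp
    refine sum_congr rfl fun i _ => ?_
    ring
  rw [sub_mul, hzder, hder]
  have e : (((d + 1 : ℕ) : ℂ) * (∑ i ∈ range (d + 2), C (c i) * X ^ i).eval z
     - ∑ i ∈ range (d + 2), (i : ℂ) * c i * z ^ i)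
     = ∑ i ∈ range (d + 1), ((d : ℂ) + 1 - i) * c i * z ^ i := by
    rw [eval_finsetSum, mul_sum, ← sum_sub_distrib, sum_range_succ]
    simp only [eval_mul, eval_C, eval_pow, eval_X]
    push_cast
    rw [show ((d : ℂ) + 1) * (c (d + 1) * z ^ (d + 1)) - ((d : ℂ) + 1) * c (d + 1) * z ^ (d + 1) = 0 by ring,
      add_zero]
    refine sum_congr rfl fun i _ => ?_
    ring
  rw [show ∀ a b c : ℂ, a + (b - c) = (a - c) + b by intros; ring, e, mul_sum, ← sum_add_distrib]
  refine sum_congr rfl fun i _ => ?_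
  ring

lemma lieb_sokal (A B C D : ℂ)
    (h : ∀ a b : ℂ, 0 ≤ a.im → 0 ≤ b.im → A + B * a + C * b + D * (a * b) ≠ 0) : A - D ≠ 0 := by
  intro hAD
  have hD : D = A := by linear_combination -hAD
  subst hD
  have hA : D ≠ 0 := by simpa using h 0 0 (by simp) (by simp)
  -- normalize
  obtain ⟨B, rfl⟩ : ∃ B', B = D * B' := ⟨B / D, by field_simp⟩
  obtain ⟨C, rfl⟩ : ∃ C', C = D * C' := ⟨C / D, by field_simp⟩
  have h' : ∀ a b : ℂ, 0 ≤ a.im → 0 ≤ b.im → 1 + B * a + C * b + a * b ≠ 0 := by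
    intro a b ha hb h0
    exact h a b ha hb (by linear_combination D * h0)
  by_cases hC : C = 0
  · by_cases hB : B = 0
    · apply h' Complex.I Complex.I (by simp) (by simp)
      simp [hB, hC]
    · by_cases hBim : 0 ≤ B.im
      · apply h' (-1 / B) 0 _ (by simp)
        · field_simp; simp
        · rw [neg_div, Complex.neg_im, one_div, Complex.inv_im]
          have := Complex.normSq_nonneg B
          rw [neg_div, neg_neg]; positivity
      · push Not at hBim
        -- a b + B a + 1 = 0, a = i t, b = - B + i / t
        apply h' Complex.I (-B + Complex.I) (by simp) (by simp; linarith)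
        rw [hC]
        linear_combination Complex.I_mul_I
  · by_cases hCim : 0 ≤ C.im
    · apply h' 0 (-1 / C) (by simp)
      · rw [neg_div, Complex.neg_im, one_div, Complex.inv_im]
        have := Complex.normSq_nonneg C
        rw [neg_div, neg_neg]; positivity
      · field_simp; simp
    · push Not at hCim
      by_cases hE : B * C = 1
      · apply h' (-C) 0 (by simp; linarith) (by simp)
        linear_combination -hE
      · -- a = -C + ε w,  b = - B + (BC-1)/(ε w)
        set E := B * C - 1 with hEdef
        have hE0 : E ≠ 0 := sub_ne_zero.mpr hE
        -- choose w = -I * E * ε ; then E/(w) = I/ε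
        have hδ : 0 < -C.im := by linarith
        obtain ⟨ε, hε, hε1, hε2⟩ : ∃ ε : ℝ, 0 < ε ∧ ε * |E.re| ≤ -C.im ∧ ε * |B.im| ≤ 1 := by
          refine ⟨min (-C.im / (|E.re| + 1)) (1 / (|B.im| + 1)), by positivity, ?_, ?_⟩
          · calc _ ≤ (-C.im / (|E.re| + 1)) * |E.re| := by gcongr; exact min_le_left _ _
              _ ≤ (-C.im / (|E.re| + 1)) * (|E.re| + 1) := by gcongr; linarith
              _ = _ := by field_simp
          · calc _ ≤ (1 / (|B.im| + 1)) * |B.im| := by gcongr; exact min_le_right _ _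
              _ ≤ (1 / (|B.im| + 1)) * (|B.im| + 1) := by gcongr; linarith
              _ = _ := by field_simp
        have hεc : (ε : ℂ) ≠ 0 := by exact_mod_cast hε.ne'
        apply h' (-C - Complex.I * E * ε) (-B + Complex.I / ε)
        · have := le_abs_self E.re
          have h3 : (-C - Complex.I * E * ε).im = -C.im - ε * E.re := by simp; ring
          rw [h3]
          nlinarith
        · have h3 : (-B + Complex.I / ε).im = - B.im + 1 / ε := by simp
          rw [h3]
          have : B.im ≤ 1 / ε := by
            rw [le_div_iff₀ hε]
            nlinarith [le_abs_self B.im]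
          linarith
        · field_simp
          linear_combination (-E * ε) * Complex.I_mul_I - ε * hEdef

lemma edge_lemma (d : ℕ) : ∀ c : ℕ → ℕ → ℂ,
    (∀ u v : ℂ, 0 ≤ u.im → 0 ≤ v.im →
      ∑ i ∈ range (d + 1), ∑ j ∈ range (d + 1), c i j * u ^ i * v ^ j ≠ 0) →
    ∑ j ∈ range (d + 1), (-1 : ℂ) ^ j * (j.factorial * (d - j).factorial) * c j j ≠ 0 := by
  induction d with
  | zero =>
    intro c h
    simpa using h 0 0 (by simp) (by simp)
  | succ d ih =>
    intro c h
    have key := ih (fun i j => ((d : ℂ) + 1 - i) * ((d : ℂ) + 1 - j) * c i j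
      - ((i : ℂ) + 1) * ((j : ℂ) + 1) * c (i + 1) (j + 1)) ?_
    · intro h0
      apply key
      have : ∑ j ∈ range (d + 1), (-1 : ℂ) ^ j * (j.factorial * (d - j).factorial) *
          (((d : ℂ) + 1 - j) * ((d : ℂ) + 1 - j) * c j j
            - ((j : ℂ) + 1) * ((j : ℂ) + 1) * c (j + 1) (j + 1))
        = (d + 1) * ∑ j ∈ range (d + 1 + 1),
          (-1 : ℂ) ^ j * (j.factorial * (d + 1 - j).factorial) * c j j := by
        have e1 : ∑ j ∈ range (d + 1), (-1 : ℂ) ^ j * (j.factorial * (d - j).factorial) *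
          (((d : ℂ) + 1 - j) * ((d : ℂ) + 1 - j) * c j j) =
          ∑ j ∈ range (d + 1 + 1), (-1 : ℂ) ^ j * (j.factorial * (d + 1 - j).factorial) *
            ((d : ℂ) + 1 - j) * c j j := by
          rw [sum_range_succ _ (d + 1)]
          push_cast
          simp only [sub_self, mul_zero, zero_mul, add_zero]
          refine sum_congr rfl fun j hj => ?_
          have hj : j ≤ d := by have := mem_range.mp hj; omega
          rw [show d + 1 - j = (d - j) + 1 by omega, Nat.factorial_succ]
          push_cast [hj]
          ring
        have e2 : ∑ j ∈ range (d + 1), (-1 : ℂ) ^ j * (j.factorial * (d - j).factorial) *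
          (((j : ℂ) + 1) * ((j : ℂ) + 1) * c (j + 1) (j + 1)) =
          - ∑ j ∈ range (d + 1 + 1), (-1 : ℂ) ^ j * (j.factorial * (d + 1 - j).factorial) *
            (j : ℂ) * c j j := by
          rw [sum_range_succ' _ (d + 1)]
          simp only [Nat.cast_zero, mul_zero, zero_mul, add_zero]
          rw [← sum_neg_distrib]
          refine sum_congr rfl fun j hj => ?_
          rw [show d + 1 - (j + 1) = d - j by omega, Nat.factorial_succ]
          push_cast
          ring
        simp only [mul_sub (_ * _), sum_sub_distrib]
        rw [e1, e2, sub_neg_eq_add, ← sum_add_distrib, mul_sum]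
        refine sum_congr rfl fun j hj => ?_
        ring
      rw [this, h0, mul_zero]
    · intro z w hz hw
      have step : ∀ ζ ξ : ℂ, 0 ≤ ζ.im → 0 ≤ ξ.im →
          ∑ j ∈ range (d + 1), (((d : ℂ) + 1 - j) *
            (∑ i ∈ range (d + 1), (((d : ℂ) + 1 - i) * c i j + ζ * (((i : ℂ) + 1) * c (i + 1) j)) * z ^ i)
            + ξ * (((j : ℂ) + 1) * (∑ i ∈ range (d + 1), (((d : ℂ) + 1 - i) * c i (j + 1)
              + ζ * (((i : ℂ) + 1) * c (i + 1) (j + 1))) * z ^ i))) * w ^ j ≠ 0 := by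
        intro ζ ξ hζ hξ
        refine laguerre_coeff (fun j => ∑ i ∈ range (d + 1), (((d : ℂ) + 1 - i) * c i j
          + ζ * (((i : ℂ) + 1) * c (i + 1) j)) * z ^ i) d ?_ w ξ hw hξ
        intro v hv
        have := laguerre_coeff (fun i => ∑ j ∈ range (d + 2), c i j * v ^ j) d ?_ z ζ hz hζ
        · convert this using 1
          simp only [sum_mul, mul_sum, ← sum_add_distrib, add_mul]
          rw [sum_comm]
          refine sum_congr rfl fun i _ => sum_congr rfl fun j _ => ?_
          ring
        · intro u hu
          convert h u v hu hv using 1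
          simp only [sum_mul]
          refine sum_congr rfl fun i _ => sum_congr rfl fun j _ => ?_
          ring
      have := lieb_sokal
        (∑ i ∈ range (d + 1), ∑ j ∈ range (d + 1), ((d : ℂ) + 1 - i) * ((d : ℂ) + 1 - j) * c i j * z ^ i * w ^ j)
        (∑ i ∈ range (d + 1), ∑ j ∈ range (d + 1), ((i : ℂ) + 1) * ((d : ℂ) + 1 - j) * c (i + 1) j * z ^ i * w ^ j)
        (∑ i ∈ range (d + 1), ∑ j ∈ range (d + 1), ((d : ℂ) + 1 - i) * ((j : ℂ) + 1) * c i (j + 1) * z ^ i * w ^ j)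
        (∑ i ∈ range (d + 1), ∑ j ∈ range (d + 1), ((i : ℂ) + 1) * ((j : ℂ) + 1) * c (i + 1) (j + 1) * z ^ i * w ^ j)
        ?_
      · convert this using 1
        simp only [← sum_sub_distrib]
        refine sum_congr rfl fun i _ => sum_congr rfl fun j _ => ?_
        ring
      · intro a b ha hb
        convert step a b ha hb using 1
        simp only [sum_mul, mul_sum, ← sum_add_distrib, add_mul]
        rw [sum_comm]
        refine sum_congr rfl fun i _ => sum_congr rfl fun j _ => ?_
        ring

lemma grace (d : ℕ) : ∀ (c : ℕ → ℂ) (q : ℂ[X]), q.natDegree = d → q ≠ 0 →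
    (∀ α, q.IsRoot α → 0 ≤ α.im) →
    (∀ u : ℂ, 0 ≤ u.im → ∑ i ∈ range (d + 1), c i * u ^ i ≠ 0) →
    ∑ i ∈ range (d + 1), (-1 : ℂ) ^ i * (i.factorial * (d - i).factorial) * c i * q.coeff (d - i) ≠ 0 := by
  induction d with
  | zero =>
    intro c q hq hq0 hr h
    have h1 := h 0 (by simp)
    have h2 : q.coeff 0 ≠ 0 := by
      rw [← hq]
      exact leadingCoeff_ne_zero.mpr hq0
    simp at h1 ⊢
    exact ⟨h1, h2⟩
  | succ d ih =>
    intro c q hq hq0 hr h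
    obtain ⟨α, hα⟩ := IsAlgClosed.exists_root q (by
      rw [degree_eq_natDegree hq0, hq]; exact_mod_cast Nat.succ_ne_zero d)
    obtain ⟨r, hqr⟩ := dvd_iff_isRoot.mpr hα
    have hr0 : r ≠ 0 := by rintro rfl; simp at hqr; exact hq0 hqr
    have hrd : r.natDegree = d := by
      have := natDegree_mul (X_sub_C_ne_zero α) hr0
      rw [← hqr, hq, natDegree_X_sub_C] at this
      omega
    have key := ih (fun i => ((d : ℂ) + 1 - i) * c i + α * (((i : ℂ) + 1) * c (i + 1))) r hrd hr0
      (fun β hβ => hr β (by rw [hqr, IsRoot.def, eval_mul, hβ, mul_zero]))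
      (fun u hu => laguerre_coeff c d h u α hu (hr α hα))
    intro h0
    apply key
    rw [← h0]
    have e1 : ∑ i ∈ range (d + 1 + 1), (-1 : ℂ) ^ i * (i.factorial * (d + 1 - i).factorial) * c i *
        q.coeff (d + 1 - i) =
       ∑ i ∈ range (d + 1 + 1), (-1 : ℂ) ^ i * (i.factorial * (d + 1 - i).factorial) * c i *
        (X * r).coeff (d + 1 - i) - ∑ i ∈ range (d + 1 + 1), (-1 : ℂ) ^ i * (i.factorial * (d + 1 - i).factorial) * c i *
        (α * r.coeff (d + 1 - i)) := by
      rw [← sum_sub_distrib]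
      refine sum_congr rfl fun i _ => ?_
      rw [hqr, sub_mul, coeff_sub, coeff_C_mul]
      ring
    rw [e1, sum_range_succ _ (d + 1), sum_range_succ' _ (d + 1)]
    have hz : r.coeff (d + 1) = 0 := coeff_eq_zero_of_natDegree_lt (by omega)
    simp only [Nat.sub_self, Nat.sub_zero, hz, coeff_X_mul_zero, mul_zero, add_zero]
    rw [← sum_sub_distrib]
    refine sum_congr rfl fun i hi => ?_
    have hi : i ≤ d := by have := mem_range.mp hi; omega
    rw [show d + 1 - (i + 1) = d - i by omega, show d + 1 - i = d - i + 1 by omega, coeff_X_mul,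
      Nat.factorial_succ, Nat.factorial_succ]
    push_cast [hi]
    ring
lemma S_coeff (d : ℕ) :
    (∀ k, d < k → (Chebyshev.S ℂ d).coeff k = 0) ∧
    (∀ j k, 2 * j + k = d → (Chebyshev.S ℂ d).coeff k = (-1) ^ j * ((j + k).choose j : ℂ)) ∧
    (∀ j k, 2 * j + 1 + k = d → (Chebyshev.S ℂ d).coeff k = 0) := by
  induction d using Nat.strong_induction_on with
  | _ d ih =>
    match d, ih with
    | 0, _ =>
      refine ⟨fun k hk => ?_, fun j k h => ?_, fun j k h => by omega⟩
      · simp [coeff_one, hk.ne']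
      · obtain ⟨rfl, rfl⟩ : j = 0 ∧ k = 0 := by omega
        simp
    | 1, _ =>
      refine ⟨fun k hk => ?_, fun j k h => ?_, fun j k h => ?_⟩
      · simp [coeff_X, hk.ne]
      · obtain ⟨rfl, rfl⟩ : j = 0 ∧ k = 1 := by omega
        simp
      · obtain ⟨rfl, rfl⟩ : j = 0 ∧ k = 0 := by omega
        simp
    | d + 2, ih =>
      obtain ⟨a1, a2, a3⟩ := ih d (by omega)
      obtain ⟨b1, b2, b3⟩ := ih (d + 1) (by omega)
      have hS : Chebyshev.S ℂ ((d + 2 : ℕ) : ℤ) =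
          X * Chebyshev.S ℂ ((d + 1 : ℕ) : ℤ) - Chebyshev.S ℂ (d : ℤ) := by
        have := Chebyshev.S_add_two ℂ (d : ℤ)
        push_cast
        exact this
      rw [hS]
      refine ⟨fun k hk => ?_, fun j k h => ?_, fun j k h => ?_⟩
      · obtain ⟨k, rfl⟩ : ∃ k', k = k' + 1 := ⟨k - 1, by omega⟩
        rw [coeff_sub, coeff_X_mul, b1 k (by omega), a1 _ (by omega), sub_zero]
      · rcases k with _ | k
        · obtain ⟨j, rfl⟩ : ∃ j', j = j' + 1 := ⟨j - 1, by omega⟩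
          rw [coeff_sub, coeff_X_mul_zero, a2 j 0 (by omega)]
          simp [pow_succ]
        · rw [coeff_sub, coeff_X_mul, b2 j k (by omega)]
          rcases j with _ | j
          · rw [a1 _ (by omega)]; simp
          · rw [a2 j (k + 1) (by omega), show j + 1 + (k + 1) = (j + 1 + k) + 1 by ring,
              Nat.choose_succ_succ, show j + (k + 1) = j + 1 + k by ring]
            push_cast
            ring
      · rcases k with _ | k
        · obtain ⟨j, rfl⟩ : ∃ j', j = j' + 1 := ⟨j - 1, by omega⟩
          rw [coeff_sub, coeff_X_mul_zero, a3 j 0 (by omega), sub_zero]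
        · rw [coeff_sub, coeff_X_mul, b3 j k (by omega)]
          rcases j with _ | j
          · rw [a1 _ (by omega), sub_zero]
          · rw [a3 j (k + 1) (by omega), sub_zero]

lemma S_root (d : ℕ) (α : ℂ) (h : (Chebyshev.S ℂ d).IsRoot α) : 0 ≤ α.im := by
  obtain ⟨θ, hθ⟩ := Complex.cos_surjective (α / 2)
  have hα : α = 2 * Complex.cos θ := by rw [hθ]; ring
  have h1 := Chebyshev.S_two_mul_complex_cos θ (d : ℤ)
  rw [← hα, h.eq_zero, zero_mul] at h1
  obtain ⟨k, hk⟩ := Complex.sin_eq_zero_iff.mp h1.symm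
  have hd : ((d : ℂ) + 1) ≠ 0 := by exact_mod_cast Nat.succ_ne_zero d
  have hθ' : θ = ((k * Real.pi / (d + 1) : ℝ) : ℂ) := by
    push_cast at hk ⊢
    field_simp
    linear_combination hk
  rw [hα, hθ', ← Complex.ofReal_cos, Complex.mul_im, Complex.ofReal_im, mul_zero, zero_add]
  simp only [Complex.im_ofNat, zero_mul, le_refl]

lemma sum_range_two_mul (F : ℕ → ℂ) (n : ℕ) :
    ∑ i ∈ range (2 * n), F i = ∑ j ∈ range n, (F (2 * j) + F (2 * j + 1)) := by
  induction n with
  | zero => simp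
  | succ n ih => rw [mul_add, mul_one, sum_range_succ, sum_range_succ, ih, sum_range_succ]; ring

lemma loop_lemma (d : ℕ) (c : ℕ → ℂ) (hc : ∀ i, d < i → c i = 0)
    (h : ∀ u : ℂ, 0 ≤ u.im → ∑ i ∈ range (d + 1), c i * u ^ i ≠ 0) :
    ∑ j ∈ range (d + 1), (-1 : ℂ) ^ j * ((d - j).factorial / j.factorial) *
      ((2 * j).factorial * c (2 * j)) ≠ 0 := by
  obtain ⟨a1, a2, a3⟩ := S_coeff d
  have hd : (Chebyshev.S ℂ d).coeff d = 1 := by rw [a2 0 d (by omega)]; simp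
  have hdeg : (Chebyshev.S ℂ d).natDegree = d := by
    apply le_antisymm
    · exact natDegree_le_iff_coeff_eq_zero.mpr a1
    · exact le_natDegree_of_ne_zero (by rw [hd]; exact one_ne_zero)
  have h0 : Chebyshev.S ℂ d ≠ 0 := by intro h; rw [h] at hd; simp at hd
  have key := grace d c _ hdeg h0 (S_root d) h
  convert key using 1
  have e : ∑ i ∈ range (d + 1), (-1 : ℂ) ^ i * (i.factorial * (d - i).factorial) * c i *
      (Chebyshev.S ℂ d).coeff (d - i) = ∑ i ∈ range (2 * (d + 1)),
      (-1 : ℂ) ^ i * (i.factorial * (d - i).factorial) * c i *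
      (Chebyshev.S ℂ d).coeff (d - i) := by
    apply sum_subset
    · intro i; simp only [mem_range]; omega
    · intro i _ hi
      rw [hc i (by simpa using hi)]; ring
  rw [e, sum_range_two_mul]
  refine sum_congr rfl fun j _ => ?_
  have hodd : (-1 : ℂ) ^ (2 * j + 1) * ((2 * j + 1).factorial * (d - (2 * j + 1)).factorial)
      * c (2 * j + 1) * (Chebyshev.S ℂ d).coeff (d - (2 * j + 1)) = 0 := by
    by_cases hj : 2 * j + 1 ≤ d
    · rw [a3 j _ (by omega), mul_zero]
    · rw [hc _ (by omega)]; ring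
  rw [hodd, add_zero]
  by_cases hj : 2 * j ≤ d
  · rw [a2 j (d - 2 * j) (by omega), show j + (d - 2 * j) = d - j by omega]
    have hch := Nat.choose_mul_factorial_mul_factorial (show j ≤ d - j by omega)
    rw [show d - j - j = d - 2 * j by omega] at hch
    have hch' : ((d - j).choose j : ℂ) * j.factorial * (d - 2 * j).factorial = (d - j).factorial := by
      exact_mod_cast hch
    rw [← hch']
    have : (j.factorial : ℂ) ≠ 0 := by exact_mod_cast j.factorial_ne_zero
    rw [pow_mul, neg_one_sq, one_pow]
    field_simp
  · rw [hc _ (by omega)]; ring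
section algebra

lemma perm_sum_prod {A : Type*} [CommRing A] [Algebra ℂ A] (b : Fin d → A) (hb : ∀ k, b k ^ 2 = 0)
    (s : Finset (Fin d)) :
    ∑ σ : Equiv.Perm (Fin d), ∏ k ∈ s, b (σ k) =
      ((d - s.card).factorial : ℂ) • (∑ k, b k) ^ s.card := by
  induction s using Finset.induction_on with
  | empty => simp [Fintype.card_perm, Algebra.smul_def]
  | insert l0 s hl ih =>
    have hcard : s.card + 1 ≤ d := by
      have := card_le_univ (insert l0 s)
      rwa [card_insert_of_notMem hl, Fintype.card_fin] at this
    have key : (∑ k, b k) * ∑ σ : Equiv.Perm (Fin d), ∏ k ∈ s, b (σ k) =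
        ((d - s.card : ℕ) : ℂ) • ∑ σ : Equiv.Perm (Fin d), ∏ k ∈ insert l0 s, b (σ k) := by
      have e1 : (∑ k, b k) * ∑ σ : Equiv.Perm (Fin d), ∏ k ∈ s, b (σ k) =
          ∑ l, ∑ σ : Equiv.Perm (Fin d), b (σ l) * ∏ k ∈ s, b (σ k) := by
        rw [sum_comm, mul_sum]
        refine sum_congr rfl fun σ _ => ?_
        rw [← sum_mul, Equiv.sum_comp σ b]
      rw [e1, ← sum_subset (subset_univ sᶜ)]
      · have : ∀ l ∈ sᶜ, ∑ σ : Equiv.Perm (Fin d), b (σ l) * ∏ k ∈ s, b (σ k) =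
            ∑ σ : Equiv.Perm (Fin d), ∏ k ∈ insert l0 s, b (σ k) := by
          intro l hls
          rw [mem_compl] at hls
          rw [← Equiv.sum_comp (Equiv.mulRight (Equiv.swap l l0))]
          refine sum_congr rfl fun σ _ => ?_
          rw [prod_insert hl]
          simp only [Equiv.coe_mulRight, Equiv.Perm.mul_apply, Equiv.swap_apply_left]
          congr 1
          refine prod_congr rfl fun k hk => ?_
          rw [Equiv.swap_apply_of_ne_of_ne]
          · rintro rfl; exact hls hk
          · rintro rfl; exact hl hk
        rw [sum_congr rfl this, sum_const, card_compl, Fintype.card_fin, Nat.cast_smul_eq_nsmul]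
      · intro l _ hls
        rw [mem_compl, not_not] at hls
        refine sum_eq_zero fun σ _ => ?_
        rw [← mul_prod_erase s _ hls, ← mul_assoc, ← sq, hb, zero_mul]
    rw [ih, mul_smul_comm, ← pow_succ'] at key
    rw [card_insert_of_notMem hl]
    have hne : ((d - s.card : ℕ) : ℂ) ≠ 0 := by
      have : d - s.card ≠ 0 := by omega
      exact_mod_cast this
    have := congrArg (fun x => ((d - s.card : ℕ) : ℂ)⁻¹ • x) key
    simp only [smul_smul, inv_mul_cancel₀ hne, one_smul] at this
    rw [← this]
    congr 1
    rw [show d - s.card = (d - (s.card + 1)) + 1 by omega, Nat.factorial_succ]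
    have hne' : ((d - (s.card + 1) + 1 : ℕ) : ℂ) ≠ 0 :=
      Nat.cast_ne_zero.mpr (Nat.succ_ne_zero _)
    push_cast at hne' ⊢
    field_simp

lemma perm_sum_edge {A : Type*} [CommRing A] [Algebra ℂ A] (a b : Fin d → A)
    (ha : ∀ k, a k ^ 2 = 0) (hb : ∀ k, b k ^ 2 = 0) :
    ∑ σ : Equiv.Perm (Fin d), ∏ k, (1 - a k * b (σ k)) =
      ∑ j ∈ range (d + 1), ((-1 : ℂ) ^ j * ((d - j).factorial / j.factorial)) •
        ((∑ k, a k) * (∑ k, b k)) ^ j := by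
  have e1 : (d.factorial : ℂ) • ∑ σ : Equiv.Perm (Fin d), ∏ k, (1 - a k * b (σ k)) =
      ∑ τ : Equiv.Perm (Fin d), ∑ σ : Equiv.Perm (Fin d), ∏ k, (1 - a (τ k) * b (σ k)) := by
    have : ∀ τ : Equiv.Perm (Fin d), ∑ σ : Equiv.Perm (Fin d), ∏ k, (1 - a (τ k) * b (σ k)) =
        ∑ σ : Equiv.Perm (Fin d), ∏ k, (1 - a k * b (σ k)) := by
      intro τ
      rw [← Equiv.sum_comp (Equiv.mulRight τ)]
      refine sum_congr rfl fun σ _ => ?_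
      exact Equiv.prod_comp τ (fun k => 1 - a k * b (σ k))
    rw [sum_congr rfl (fun τ _ => this τ), sum_const, card_univ, Fintype.card_perm,
      Fintype.card_fin, Nat.cast_smul_eq_nsmul]
  have e2 : ∑ τ : Equiv.Perm (Fin d), ∑ σ : Equiv.Perm (Fin d), ∏ k, (1 - a (τ k) * b (σ k)) =
      ∑ s ∈ (univ : Finset (Fin d)).powerset, ((-1 : ℂ) ^ s.card * ((d - s.card).factorial) ^ 2) •
        ((∑ k, a k) * (∑ k, b k)) ^ s.card := by
    have : ∀ τ σ : Equiv.Perm (Fin d), ∏ k, (1 - a (τ k) * b (σ k)) =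
        ∑ s ∈ (univ : Finset (Fin d)).powerset, ((-1 : ℂ) ^ s.card) •
          ((∏ k ∈ s, a (τ k)) * ∏ k ∈ s, b (σ k)) := by
      intro τ σ
      simp only [sub_eq_add_neg]
      rw [prod_one_add]
      refine sum_congr rfl fun s _ => ?_
      rw [prod_neg, prod_mul_distrib, Algebra.smul_def]
      simp
    simp only [this]
    rw [sum_congr rfl (fun τ _ => sum_comm), sum_comm]
    refine sum_congr rfl fun s _ => ?_
    simp only [← smul_sum, ← mul_sum, ← sum_mul]
    rw [perm_sum_prod a ha, perm_sum_prod b hb, smul_mul_smul_comm, smul_smul, mul_pow, sq]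
  have hd0 : (d.factorial : ℂ) ≠ 0 := by exact_mod_cast d.factorial_ne_zero
  have e3 := e1.trans e2
  rw [sum_powerset_apply_card (fun j => ((-1 : ℂ) ^ j * ((d - j).factorial) ^ 2) •
        ((∑ k, a k) * (∑ k, b k)) ^ j), card_univ, Fintype.card_fin] at e3
  have := congrArg (fun x => (d.factorial : ℂ)⁻¹ • x) e3
  simp only [smul_smul, inv_mul_cancel₀ hd0, one_smul, smul_sum] at this
  rw [this]
  refine sum_congr rfl fun j hj => ?_
  rw [← Nat.cast_smul_eq_nsmul ℂ, smul_smul, smul_smul]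
  congr 1
  have hj : j ≤ d := by have := mem_range.mp hj; omega
  have hch : (d.choose j : ℂ) * j.factorial * (d - j).factorial = d.factorial := by
    exact_mod_cast Nat.choose_mul_factorial_mul_factorial hj
  have h1 : (j.factorial : ℂ) ≠ 0 := by exact_mod_cast j.factorial_ne_zero
  field_simp
  rw [← hch]
  ring

end algebra
section psi

open MvPolynomial in
/-- `Psi d p` is the polynomial `p(∂) ∏ v, X v ^ d`, defined on monomials. -/
noncomputable def Psi {ι : Type} [Fintype ι] (d : ℕ) : MvPolynomial ι ℂ →ₗ[ℂ] MvPolynomial ι ℂ :=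
  (MvPolynomial.basisMonomials ι ℂ).constr ℂ (fun κ =>
    monomial (Finsupp.equivFunOnFinite.symm (fun v => d - κ v))
      (∏ v, (d.descFactorial (κ v) : ℂ)))

variable {ι : Type} [Fintype ι]

lemma Psi_monomial (d : ℕ) (κ : ι →₀ ℕ) (a : ℂ) :
    Psi d (MvPolynomial.monomial κ a) =
    MvPolynomial.monomial (Finsupp.equivFunOnFinite.symm (fun v => d - κ v))
      (a * ∏ v, (d.descFactorial (κ v) : ℂ)) := by
  have h1 : MvPolynomial.monomial κ a = a • (MvPolynomial.basisMonomials ι ℂ) κ := by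
    simp [MvPolynomial.smul_monomial]
  rw [h1, map_smul, Psi, Module.Basis.constr_basis, MvPolynomial.smul_monomial, smul_eq_mul]

lemma eval_Psi_monomial (d : ℕ) (κ : ι →₀ ℕ) (a : ℂ) (z : ι → ℂ) :
    MvPolynomial.eval z (Psi d (MvPolynomial.monomial κ a)) =
      a * ∏ v, ((d.descFactorial (κ v) : ℂ) * z v ^ (d - κ v)) := by
  rw [Psi_monomial, MvPolynomial.eval_monomial, Finsupp.prod_fintype _ _ (by simp), prod_mul_distrib,
    mul_assoc]
  rfl

lemma pderiv_Psi (d : ℕ) (i : ι) (p : MvPolynomial ι ℂ) :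
    MvPolynomial.pderiv i (Psi d p) = Psi d (MvPolynomial.X i * p) := by
  induction p using MvPolynomial.induction_on' with
  | monomial κ a =>
    rw [Psi_monomial, MvPolynomial.pderiv_monomial, MvPolynomial.X, MvPolynomial.monomial_mul,
      Psi_monomial, one_mul]
    refine congrArg₂ (fun s a => MvPolynomial.monomial s a) ?_ ?_
    · ext v
      by_cases h : v = i
      · subst h; simp; omega
      · simp [Finsupp.single_apply, Ne.symm h]
    · rw [mul_assoc]
      congr 1
      rw [← mul_prod_erase univ _ (mem_univ i), ← mul_prod_erase univ _ (mem_univ i)]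
      have : ∏ x ∈ univ.erase i, (d.descFactorial ((Finsupp.single i 1 + κ : ι →₀ ℕ) x) : ℂ) =
          ∏ x ∈ univ.erase i, (d.descFactorial (κ x) : ℂ) := by
        refine prod_congr rfl fun x hx => ?_
        have : i ≠ x := (ne_of_mem_erase hx).symm
        simp [Finsupp.single_apply, this]
      rw [this, Finsupp.add_apply, Finsupp.single_eq_same, add_comm 1, Nat.descFactorial_succ]
      simp only [Finsupp.equivFunOnFinite_symm_apply_apply]
      push_cast
      ring
  | add p q hp hq => simp only [map_add, mul_add, hp, hq]

lemma Psi_X_pow_eq_zero (d k : ℕ) (hk : d < k) (i : ι) (p : MvPolynomial ι ℂ) :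
    Psi d (MvPolynomial.X i ^ k * p) = 0 := by
  induction p using MvPolynomial.induction_on' with
  | monomial κ a =>
    rw [MvPolynomial.X_pow_eq_monomial, MvPolynomial.monomial_mul, Psi_monomial,
      prod_eq_zero (mem_univ i), mul_zero, map_zero]
    rw [Nat.cast_eq_zero, Nat.descFactorial_eq_zero_iff_lt]
    simp; omega
  | add p q hp hq => rw [mul_add, map_add, hp, hq, add_zero]

lemma desc_taylor (d k : ℕ) (x u : ℂ) :
    (d.descFactorial k : ℂ) * (x + u) ^ (d - k) =
      ∑ i ∈ range (d + 1), u ^ i / i.factorial *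
        ((d.descFactorial (k + i) : ℂ) * x ^ (d - (k + i))) := by
  by_cases hk : k ≤ d
  · rw [add_comm x u, add_pow, mul_sum]
    have : ∑ i ∈ range (d + 1), u ^ i / i.factorial *
        ((d.descFactorial (k + i) : ℂ) * x ^ (d - (k + i))) = ∑ i ∈ range (d - k + 1), u ^ i / i.factorial *
        ((d.descFactorial (k + i) : ℂ) * x ^ (d - (k + i))) := by
      symm
      apply sum_subset
      · intro i; simp only [mem_range]; omega
      · intro i _ hi
        rw [Nat.descFactorial_eq_zero_iff_lt.mpr (by simp at hi; omega)]
        simp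
    rw [this]
    refine sum_congr rfl fun i _ => ?_
    have h1 := Nat.descFactorial_mul_descFactorial (n := d) (show k ≤ k + i by omega)
    rw [Nat.add_sub_cancel_left, Nat.descFactorial_eq_factorial_mul_choose] at h1
    rw [← h1, Nat.sub_sub]
    have : (i.factorial : ℂ) ≠ 0 := by exact_mod_cast i.factorial_ne_zero
    push_cast
    field_simp
  · rw [Nat.descFactorial_eq_zero_iff_lt.mpr (by omega)]
    symm
    simp only [Nat.cast_zero, zero_mul]
    refine sum_eq_zero fun i _ => ?_
    rw [Nat.descFactorial_eq_zero_iff_lt.mpr (by omega)]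
    simp

lemma Psi_taylor (d : ℕ) (h : ι) (u : ℂ) (z : ι → ℂ) (p : MvPolynomial ι ℂ) :
    MvPolynomial.eval (Function.update z h (z h + u)) (Psi d p) =
      ∑ i ∈ range (d + 1), u ^ i / i.factorial *
        MvPolynomial.eval z (Psi d (MvPolynomial.X h ^ i * p)) := by
  induction p using MvPolynomial.induction_on' with
  | monomial κ a =>
    simp only [MvPolynomial.X_pow_eq_monomial, MvPolynomial.monomial_mul, eval_Psi_monomial, one_mul]
    simp only [← mul_prod_erase univ _ (mem_univ h)]
    have e1 : ∏ x ∈ univ.erase h, ((d.descFactorial (κ x) : ℂ) *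
        Function.update z h (z h + u) x ^ (d - κ x)) =
        ∏ x ∈ univ.erase h, ((d.descFactorial (κ x) : ℂ) * z x ^ (d - κ x)) := by
      refine prod_congr rfl fun x hx => ?_
      rw [Function.update_of_ne (ne_of_mem_erase hx)]
    have e2 : ∀ i, ∏ x ∈ univ.erase h, ((d.descFactorial ((Finsupp.single h i + κ : ι →₀ ℕ) x) : ℂ) *
        z x ^ (d - (Finsupp.single h i + κ : ι →₀ ℕ) x)) =
        ∏ x ∈ univ.erase h, ((d.descFactorial (κ x) : ℂ) * z x ^ (d - κ x)) := by
      intro i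
      refine prod_congr rfl fun x hx => ?_
      have : h ≠ x := (ne_of_mem_erase hx).symm
      simp [Finsupp.single_apply, this]
    simp only [e1, e2]
    simp only [Function.update_self, Finsupp.add_apply, Finsupp.single_eq_same]
    rw [desc_taylor, sum_mul, mul_sum]
    refine sum_congr rfl fun i _ => ?_
    rw [add_comm i]
    ring
  | add p q hp hq =>
    simp only [map_add, mul_add, hp, hq, sum_add_distrib]

/-- The edge polynomial. -/
noncomputable def Tpoly (d : ℕ) (h t : ι) : MvPolynomial ι ℂ :=
  ∑ j ∈ range (d + 1), ((-1 : ℂ) ^ j * ((d - j).factorial / j.factorial)) •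
    (MvPolynomial.X h * MvPolynomial.X t) ^ j

/-- Stability of `Psi d p`. -/
def StableP (d : ℕ) (p : MvPolynomial ι ℂ) : Prop :=
  ∀ z : ι → ℂ, (∀ v, 0 < (z v).im) → MvPolynomial.eval z (Psi d p) ≠ 0

lemma stable_one (d : ℕ) : StableP d (1 : MvPolynomial ι ℂ) := by
  intro z hz
  have : (1 : MvPolynomial ι ℂ) = MvPolynomial.monomial 0 1 := rfl
  rw [this, eval_Psi_monomial]
  simp
  refine prod_ne_zero_iff.mpr fun v _ => pow_ne_zero _ ?_
  intro h0
  have := hz v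
  rw [h0] at this
  simp at this

lemma im_update (z : ι → ℂ) (hz : ∀ v, 0 < (z v).im) (h : ι) (u : ℂ) (hu : 0 ≤ u.im) :
    ∀ v, 0 < (Function.update z h (z h + u) v).im := by
  intro v
  by_cases hv : v = h
  · subst hv
    have := hz v
    simp; linarith
  · rw [Function.update_of_ne hv]; exact hz v

lemma stable_mul (d : ℕ) (h t : ι) (p : MvPolynomial ι ℂ) (hp : StableP d p) :
    StableP d (Tpoly d h t * p) := by
  intro z hz
  have hexp : MvPolynomial.eval z (Psi d (Tpoly d h t * p)) =
      ∑ j ∈ range (d + 1), ((-1 : ℂ) ^ j * ((d - j).factorial / j.factorial)) *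
        MvPolynomial.eval z (Psi d ((MvPolynomial.X h * MvPolynomial.X t) ^ j * p)) := by
    simp only [Tpoly, sum_mul, map_sum, smul_mul_assoc, map_smul, MvPolynomial.smul_eval]
  rw [hexp]
  by_cases hht : h = t
  · subst hht
    have := loop_lemma d (fun i => MvPolynomial.eval z (Psi d (MvPolynomial.X h ^ i * p)) / i.factorial)
      (fun i hi => by rw [Psi_X_pow_eq_zero d i hi]; simp) ?_
    · convert this using 1
      refine sum_congr rfl fun j _ => ?_
      have hf : ((2 * j).factorial : ℂ) ≠ 0 := by exact_mod_cast (2 * j).factorial_ne_zero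
      rw [mul_div_cancel₀ _ hf, ← sq, ← pow_mul]
    · intro u hu
      have := hp _ (im_update z hz h u hu)
      rw [Psi_taylor] at this
      convert this using 1
      refine sum_congr rfl fun i _ => ?_
      ring
  · have := edge_lemma d (fun i j => MvPolynomial.eval z (Psi d (MvPolynomial.X t ^ j *
      (MvPolynomial.X h ^ i * p))) / (i.factorial * j.factorial)) ?_
    · convert this using 1
      refine sum_congr rfl fun j _ => ?_
      have hf : (j.factorial : ℂ) ≠ 0 := by exact_mod_cast j.factorial_ne_zero
      rw [← mul_assoc (MvPolynomial.X t ^ j), ← mul_pow, mul_comm (MvPolynomial.X t)]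
      field_simp
    · intro u v hu hv
      have := hp _ (im_update _ (im_update z hz t v hv) h u hu)
      rw [Psi_taylor] at this
      simp only [Psi_taylor] at this
      convert this using 1
      refine sum_congr rfl fun i _ => ?_
      rw [mul_sum]
      refine sum_congr rfl fun j _ => ?_
      field_simp

lemma stable_prod {κ : Type} (d : ℕ) (s : Finset κ) (h t : κ → ι) :
    StableP d (∏ e ∈ s, Tpoly d (h e) (t e)) := by
  induction s using Finset.induction_on with
  | empty => simpa using stable_one d
  | insert e s he ih => rw [prod_insert he]; exact stable_mul d _ _ _ ih

/-- The ideal generated by squares of variables. -/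
noncomputable def sqIdeal (ι : Type) : Ideal (MvPolynomial ι ℂ) :=
  Ideal.span (Set.range fun v : ι => (MvPolynomial.X v : MvPolynomial ι ℂ) ^ 2)

lemma Psi_sqIdeal (x : MvPolynomial ι ℂ) (hx : x ∈ sqIdeal ι) : Psi 1 x = 0 := by
  have : ∀ q, Psi 1 (x * q) = 0 := by
    refine Submodule.span_induction (p := fun x _ => ∀ q, Psi 1 (x * q) = 0) ?_ ?_ ?_ ?_ hx
    · rintro _ ⟨v, rfl⟩ q
      exact Psi_X_pow_eq_zero 1 2 (by omega) v q
    · intro q; simp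
    · intro x y _ _ hx hy q
      rw [add_mul, map_add, hx, hy, add_zero]
    · intro a x _ hx q
      rw [smul_eq_mul, mul_comm a, mul_assoc]
      exact hx _
  simpa using this 1

end psi

lemma pderiv_rename_fst (h : Fin n) (q : MvPolynomial (Fin n × Fin d) ℂ) :
    MvPolynomial.pderiv h (MvPolynomial.rename Prod.fst q) =
      ∑ k : Fin d, MvPolynomial.rename Prod.fst (MvPolynomial.pderiv (h, k) q) := by
  induction q using MvPolynomial.induction_on with
  | C a => simp
  | add p q hp hq => simp only [map_add, hp, hq, sum_add_distrib]
  | mul_X p v hp =>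
    obtain ⟨v, k⟩ := v
    simp only [map_mul, Derivation.leibniz, MvPolynomial.rename_X, hp, smul_eq_mul, map_add,
      sum_add_distrib, ← mul_sum, MvPolynomial.pderiv_X]
    congr 1
    congr 1
    by_cases hv : v = h
    · subst hv
      rw [Pi.single_eq_same]
      rw [sum_eq_single k]
      · simp
      · intro b _ hb
        rw [Pi.single_eq_of_ne (by simpa using hb.symm), map_zero]
      · simp
    · rw [Pi.single_eq_of_ne hv]
      symm
      refine sum_eq_zero fun b _ => ?_
      rw [Pi.single_eq_of_ne (by simp [hv]), map_zero]

/-- The substitution sending a variable to the sum over its fiber. -/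
noncomputable def fib (n d : ℕ) : MvPolynomial (Fin n) ℂ →ₐ[ℂ] MvPolynomial (Fin n × Fin d) ℂ :=
  MvPolynomial.aeval (fun v => ∑ k : Fin d, MvPolynomial.X (v, k))

lemma rename_Psi_fib (p : MvPolynomial (Fin n) ℂ) :
    MvPolynomial.rename Prod.fst (Psi 1 (fib n d p)) = Psi d p := by
  induction p using MvPolynomial.induction_on with
  | C a =>
    have hC : fib n d (MvPolynomial.C a) = MvPolynomial.C a := by
      rw [← MvPolynomial.algebraMap_eq, AlgHom.commutes, MvPolynomial.algebraMap_eq]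
    rw [hC, MvPolynomial.C_apply, MvPolynomial.C_apply, Psi_monomial, Psi_monomial,
      MvPolynomial.rename_monomial]
    refine congrArg₂ (fun s a => MvPolynomial.monomial s a) ?_ ?_
    · ext v
      rw [Finsupp.mapDomain, Finsupp.sum_fintype _ _ (by simp)]
      simp [Finsupp.finsetSum_apply, Fintype.sum_prod_type, Finsupp.single_apply]
    · simp
  | add p q hp hq => simp only [map_add, hp, hq]
  | mul_X p v hp =>
    rw [mul_comm p, ← pderiv_Psi, ← hp, pderiv_rename_fst]
    simp only [pderiv_Psi, ← map_sum, ← sum_mul]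
    congr 2
    rw [map_mul]
    congr 1
    simp [fib]

lemma edge_congr (h t : Fin n) :
    (∑ σ : Equiv.Perm (Fin d), ∏ k, (1 - MvPolynomial.X (h, k) * MvPolynomial.X (t, σ k)) :
      MvPolynomial (Fin n × Fin d) ℂ) - fib n d (Tpoly d h t) ∈ sqIdeal (Fin n × Fin d) := by
  rw [← Ideal.Quotient.eq]
  have hsq : ∀ v : Fin n × Fin d,
      (Ideal.Quotient.mk (sqIdeal (Fin n × Fin d)) (MvPolynomial.X v)) ^ 2 = 0 := by
    intro v
    rw [← map_pow, Ideal.Quotient.eq_zero_iff_mem]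
    exact Ideal.subset_span ⟨v, rfl⟩
  have := perm_sum_edge
    (fun k => Ideal.Quotient.mk (sqIdeal (Fin n × Fin d)) (MvPolynomial.X (h, k)))
    (fun k => Ideal.Quotient.mk (sqIdeal (Fin n × Fin d)) (MvPolynomial.X (t, k)))
    (fun k => hsq _) (fun k => hsq _)
  simp only [map_sum, map_prod, map_sub, map_one, map_mul]
  rw [this, Tpoly]
  simp only [map_sum, map_smul, map_pow, map_mul]
  rw [fib]
  simp only [MvPolynomial.aeval_X, ← Ideal.Quotient.mkₐ_eq_mk ℂ, map_smul, map_pow, map_mul, map_sum]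

lemma prod_congr_ideal {R κ : Type*} [CommRing R] (I : Ideal R) (s : Finset κ) (f g : κ → R)
    (h : ∀ e, f e - g e ∈ I) : ∏ e ∈ s, f e - ∏ e ∈ s, g e ∈ I := by
  rw [← Ideal.Quotient.eq, map_prod, map_prod]
  exact prod_congr rfl fun e _ => Ideal.Quotient.eq.mpr (h e)
lemma matching_iff (hd tl : Fin m → Fin n) (σ : Fin m → Equiv.Perm (Fin d))
    (M : Finset (Fin m × Fin d)) :
    IsCovMatching hd tl σ M ↔ ∀ v : Fin n × Fin d,
      ∑ p ∈ M, ((if (hd p.1, p.2) = v then 1 else 0) +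
        (if (tl p.1, σ p.1 p.2) = v then 1 else 0)) ≤ 1 := by
  constructor
  · rintro ⟨h1, h2⟩ v
    by_cases hex : ∃ p ∈ M, v ∈ endpoints hd tl σ p
    · obtain ⟨p, hp, hv⟩ := hex
      rw [sum_eq_single_of_mem p hp]
      · have := h1 p hp
        by_cases ha : (hd p.1, p.2) = v
        · by_cases hb : (tl p.1, σ p.1 p.2) = v
          · exfalso
            apply this
            rw [← hb] at ha
            have := Prod.ext_iff.mp ha
            exact ⟨this.1, this.2.symm⟩
          · simp [ha, hb]
        · rw [if_neg ha]; split_ifs <;> simp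
      · intro q hq hqp
        have hdis := h2 p hp q hq hqp.symm
        have hvq := Finset.disjoint_left.mp hdis hv
        simp only [endpoints, mem_insert, mem_singleton, not_or] at hvq
        rw [if_neg (fun h => hvq.1 h.symm), if_neg (fun h => hvq.2 h.symm), add_zero]
    · push Not at hex
      rw [sum_eq_zero]
      · omega
      · intro p hp
        have := hex p hp
        simp only [endpoints, mem_insert, mem_singleton, not_or] at this
        rw [if_neg (fun h => this.1 h.symm), if_neg (fun h => this.2 h.symm), add_zero]
  · intro h
    refine ⟨fun p hp hloop => ?_, fun p hp q hq hpq => ?_⟩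
    · have h1 := h (hd p.1, p.2)
      have h2 := single_le_sum (f := fun p' : Fin m × Fin d =>
        ((if (hd p'.1, p'.2) = (hd p.1, p.2) then 1 else 0) +
        (if (tl p'.1, σ p'.1 p'.2) = (hd p.1, p.2) then 1 else 0) : ℕ)) (fun _ _ => Nat.zero_le _) hp
      simp only [if_true] at h2
      rw [if_pos (by rw [hloop.1, hloop.2])] at h2
      omega
    · rw [Finset.disjoint_left]
      intro v hvp hvq
      have h1 := h v
      have h2 := sum_le_sum_of_subset (f := fun p' : Fin m × Fin d =>
        ((if (hd p'.1, p'.2) = v then 1 else 0) +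
        (if (tl p'.1, σ p'.1 p'.2) = v then 1 else 0) : ℕ))
        (show ({p, q} : Finset (Fin m × Fin d)) ⊆ M by
          intro x; simp only [mem_insert, mem_singleton]; rintro (rfl | rfl) <;> assumption)
      rw [sum_pair hpq] at h2
      have h3 : ∀ r : Fin m × Fin d, v ∈ endpoints hd tl σ r →
          1 ≤ ((if (hd r.1, r.2) = v then 1 else 0) +
            (if (tl r.1, σ r.1 r.2) = v then 1 else 0) : ℕ) := by
        intro r hr
        simp only [endpoints, mem_insert, mem_singleton] at hr
        rcases hr with hr | hr
        · rw [if_pos hr.symm]; omega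
        · rw [if_pos hr.symm]; omega
      have := h3 p hvp
      have := h3 q hvq
      omega

lemma eval_Psi_matching (hd tl : Fin m → Fin n) (σ : Fin m → Equiv.Perm (Fin d))
    (M : Finset (Fin m × Fin d)) (z : ℂ) :
    MvPolynomial.eval (fun _ => z) (Psi 1 (∏ p ∈ M, (MvPolynomial.X (hd p.1, p.2) *
      MvPolynomial.X (tl p.1, σ p.1 p.2) : MvPolynomial (Fin n × Fin d) ℂ))) =
    if IsCovMatching hd tl σ M then z ^ (n * d - 2 * M.card) else 0 := by
  set κ : (Fin n × Fin d) →₀ ℕ := ∑ p ∈ M, (Finsupp.single (hd p.1, p.2) 1 +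
    Finsupp.single (tl p.1, σ p.1 p.2) 1) with hκ
  have hmon : (∏ p ∈ M, (MvPolynomial.X (hd p.1, p.2) *
      MvPolynomial.X (tl p.1, σ p.1 p.2) : MvPolynomial (Fin n × Fin d) ℂ)) =
      MvPolynomial.monomial κ 1 := by
    rw [hκ, MvPolynomial.monomial_sum_one]
    refine prod_congr rfl fun p _ => ?_
    rw [MvPolynomial.X, MvPolynomial.X, MvPolynomial.monomial_mul, one_mul]
  have hκv : ∀ v, κ v = ∑ p ∈ M, ((if (hd p.1, p.2) = v then 1 else 0) +
        (if (tl p.1, σ p.1 p.2) = v then 1 else 0)) := by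
    intro v
    rw [hκ, Finsupp.finsetSum_apply]
    refine sum_congr rfl fun p _ => ?_
    rw [Finsupp.add_apply, Finsupp.single_apply, Finsupp.single_apply]
  rw [hmon, eval_Psi_monomial, one_mul]
  have hiff := matching_iff hd tl σ M
  simp only [← hκv] at hiff
  split_ifs with hM
  · have hle := hiff.mp hM
    have : ∀ v ∈ (univ : Finset (Fin n × Fin d)),
        ((Nat.descFactorial 1 (κ v) : ℂ) * z ^ (1 - κ v)) = z ^ (1 - κ v) := by
      intro v _
      have := hle v
      have h01 : κ v = 0 ∨ κ v = 1 := by omega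
      rcases h01 with h | h <;> simp [h]
    rw [prod_congr rfl this, prod_pow_eq_pow_sum]
    congr 1
    rw [sum_tsub_distrib _ (fun v _ => hle v)]
    simp only [sum_const, card_univ, Fintype.card_prod, Fintype.card_fin, smul_eq_mul, mul_one]
    congr 1
    simp only [hκv]
    rw [sum_comm]
    simp only [sum_add_distrib, sum_ite_eq, mem_univ, if_true, sum_const, smul_eq_mul]
    omega
  · rw [hiff] at hM
    push Not at hM
    obtain ⟨v, hv⟩ := hM
    apply prod_eq_zero (mem_univ v)
    rw [Nat.descFactorial_eq_zero_iff_lt.mpr hv]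
    simp

lemma eval_covMatchPoly (hd tl : Fin m → Fin n) (σ : Fin m → Equiv.Perm (Fin d)) (z : ℂ) :
    ((covMatchPoly hd tl σ).map (algebraMap ℝ ℂ)).eval z =
      MvPolynomial.eval (fun _ => z) (Psi 1 (∏ e : Fin m, ∏ k : Fin d,
        (1 - MvPolynomial.X (hd e, k) * MvPolynomial.X (tl e, σ e k) :
          MvPolynomial (Fin n × Fin d) ℂ))) := by
  rw [← Fintype.prod_prod_type' (fun (e : Fin m) (k : Fin d) =>
    (1 - MvPolynomial.X (hd e, k) * MvPolynomial.X (tl e, σ e k) :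
          MvPolynomial (Fin n × Fin d) ℂ))]
  have : (∏ x : Fin m × Fin d, (1 - MvPolynomial.X (hd x.1, x.2) * MvPolynomial.X (tl x.1, σ x.1 x.2) :
          MvPolynomial (Fin n × Fin d) ℂ)) = ∑ M : Finset (Fin m × Fin d), ((-1 : ℂ) ^ M.card) •
      ∏ p ∈ M, (MvPolynomial.X (hd p.1, p.2) *
        MvPolynomial.X (tl p.1, σ p.1 p.2) : MvPolynomial (Fin n × Fin d) ℂ) := by
    simp only [sub_eq_add_neg]
    rw [prod_one_add, powerset_univ]
    refine sum_congr rfl fun M _ => ?_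
    rw [prod_neg, Algebra.smul_def]
    simp
  rw [this]
  simp only [map_sum, map_smul, MvPolynomial.smul_eval, eval_Psi_matching]
  rw [covMatchPoly, Polynomial.map_sum, eval_finsetSum, sum_filter]
  refine sum_congr rfl fun M _ => ?_
  split_ifs
  · simp [Polynomial.smul_eq_C_mul]
  · simp

lemma dMatch_ne_zero (hd tl : Fin m → Fin n) (d : ℕ) (z : ℂ) (hz : 0 < z.im) :
    ((dMatchPoly hd tl d).map (algebraMap ℝ ℂ)).eval z ≠ 0 := by
  have hcard : ((Fintype.card (Fin m → Equiv.Perm (Fin d)) : ℝ)⁻¹ : ℝ) ≠ 0 :=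
    inv_ne_zero (Nat.cast_ne_zero.mpr Fintype.card_ne_zero)
  rw [dMatchPoly, Polynomial.smul_eq_C_mul, Polynomial.map_mul, Polynomial.map_C, eval_mul, eval_C,
    Polynomial.map_sum, eval_finsetSum]
  refine mul_ne_zero (by simpa using hcard) ?_
  simp only [eval_covMatchPoly]
  rw [← map_sum, ← map_sum]
  have h1 : (∑ σ : Fin m → Equiv.Perm (Fin d), ∏ e : Fin m, ∏ k : Fin d,
        (1 - MvPolynomial.X (hd e, k) * MvPolynomial.X (tl e, σ e k) :
          MvPolynomial (Fin n × Fin d) ℂ)) =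
      ∏ e : Fin m, ∑ σ : Equiv.Perm (Fin d), ∏ k : Fin d,
        (1 - MvPolynomial.X (hd e, k) * MvPolynomial.X (tl e, σ k)) := by
    rw [prod_univ_sum, Fintype.piFinset_univ]
  have h2 := Psi_sqIdeal _ (prod_congr_ideal (sqIdeal (Fin n × Fin d)) univ _ _
    (fun e : Fin m => edge_congr (d := d) (hd e) (tl e)))
  rw [map_sub, sub_eq_zero] at h2
  rw [h1, h2, ← map_prod]
  have h3 : MvPolynomial.eval (fun _ : Fin n × Fin d => z)
      (Psi 1 (fib n d (∏ e : Fin m, Tpoly d (hd e) (tl e)))) =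
      MvPolynomial.eval (fun _ : Fin n => z) (Psi d (∏ e : Fin m, Tpoly d (hd e) (tl e))) := by
    rw [← rename_Psi_fib, MvPolynomial.eval_rename]
    rfl
  rw [h3]
  exact stable_prod d univ hd tl _ (fun _ => hz)

/-- For any finite multigraph (possibly with loops) and any `d ≥ 1`, the
`d`-matching polynomial is real-rooted: all its complex roots are real. -/
theorem stmt_9 (hd tl : Fin m → Fin n) (d : ℕ) (hd1 : 1 ≤ d) :
    ∀ z : ℂ, ((dMatchPoly hd tl d).map (algebraMap ℝ ℂ)).IsRoot z → z.im = 0 := by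
  intro z hz
  rcases lt_trichotomy z.im 0 with h | h | h
  · exfalso
    apply dMatch_ne_zero hd tl d (starRingEnd ℂ z) (by simpa using h)
    rw [Polynomial.eval_map_algebraMap, Polynomial.aeval_conj]
    rw [IsRoot.def, Polynomial.eval_map_algebraMap] at hz
    rw [hz, map_zero]
  · exact h
  · exact absurd hz (dMatch_ne_zero hd tl d z h)
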